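/- arXiv:1905.02313 — 7 statements merged into one kernel-verified Lean document; each statement's English description precedes it below -/
import Mathlib

section
/- Let f : ℝ^d → ℝ be μ-strongly convex and L-smooth (continuously differentiable). Let x, y : [0,∞) → ℝ^d be twice differentiable curves satisfying the Hamiltonian ODE x''(t) = -∇f(x(t)) and y''(t) = -∇f(y(t)), with equal initial velocities x'(0) = y'(0). Then for every t with 0 ≤ t ≤ 1/(2√L), one has ‖x(t) - y(t)‖² ≤ (1 - (μ/4)·t²)·‖x(0) - y(0)‖². -/
open Real
open scoped InnerProductSpace

theorem le_of_hasDerivAt_nonneg {F F' : ℝ → ℝ} {T : ℝ} (hT : 0 ≤ T)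
    (hF : ∀ s ∈ Set.Icc 0 T, HasDerivAt F (F' s) s) (hF' : ∀ s ∈ Set.Icc 0 T, 0 ≤ F' s) :
    F 0 ≤ F T := by
  refine monotoneOn_of_hasDerivWithinAt_nonneg (f' := F') (convex_Icc 0 T)
    (fun s hs => (hF s hs).continuousAt.continuousWithinAt)
    (fun s hs => (hF s (interior_subset hs)).hasDerivWithinAt)
    (fun s hs => hF' s (interior_subset hs)) ⟨le_rfl, hT⟩ ⟨hT, le_rfl⟩ hT

section Gradient

variable {E : Type*} [NormedAddCommGroup E] [InnerProductSpace ℝ E] [CompleteSpace E]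
  {f : E → ℝ} {L : ℝ}

/-- The quadratic upper bound for a function with Lipschitz gradient. -/
theorem le_add_inner_gradient_add_sq (hf : Differentiable ℝ f)
    (hL : ∀ a b, ‖gradient f a - gradient f b‖ ≤ L * ‖a - b‖) (a b : E) :
    f b ≤ f a + ⟪gradient f a, b - a⟫_ℝ + L / 2 * ‖b - a‖ ^ 2 := by
  set e := b - a with he
  have hline (s : ℝ) : HasDerivAt (fun s : ℝ => a + s • e) e s := by
    simpa using ((hasDerivAt_id s).smul_const e).const_add a
  have hfline (s : ℝ) :
      HasDerivAt (fun s : ℝ => f (a + s • e)) ⟪gradient f (a + s • e), e⟫_ℝ s := by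
    exact (hf (a + s • e)).hasGradientAt.hasFDerivAt.comp_hasDerivAt s (hline s)
  have h := le_of_hasDerivAt_nonneg zero_le_one
    (F := fun s => s * ⟪gradient f a, e⟫_ℝ + L / 2 * ‖e‖ ^ 2 * s ^ 2 - f (a + s • e))
    (F' := fun s => ⟪gradient f a, e⟫_ℝ + L * ‖e‖ ^ 2 * s - ⟪gradient f (a + s • e), e⟫_ℝ)
    (fun s _ => by
      refine ((((hasDerivAt_id s).mul_const _).add
        ((hasDerivAt_pow 2 s).const_mul (L / 2 * ‖e‖ ^ 2))).sub (hfline s)).congr_deriv ?_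
      push_cast
      ring)
    (fun s hs => by
      have h1 := real_inner_le_norm (gradient f (a + s • e) - gradient f a) e
      have h2 := hL (a + s • e) a
      rw [add_sub_cancel_left, norm_smul, Real.norm_of_nonneg hs.1] at h2
      rw [inner_sub_left] at h1
      nlinarith [mul_le_mul_of_nonneg_right h2 (norm_nonneg e)])
  have hb : a + e = b := by simp [he]
  simp only [zero_smul, one_smul, add_zero, hb] at h
  linarith

/-- Cocoercivity of the gradient (Baillon-Haddad). -/
theorem norm_gradient_sub_sq_le (hf : Differentiable ℝ f) (hLpos : 0 < L)
    (hconv : ∀ a b, f a + ⟪gradient f a, b - a⟫_ℝ ≤ f b)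
    (hL : ∀ a b, ‖gradient f a - gradient f b‖ ≤ L * ‖a - b‖) (a b : E) :
    ‖gradient f a - gradient f b‖ ^ 2 ≤ L * ⟪a - b, gradient f a - gradient f b⟫_ℝ := by
  have key (a b : E) : ‖gradient f a - gradient f b‖ ^ 2 ≤
      2 * L * (f b - f a - ⟪gradient f a, b - a⟫_ℝ) := by
    set p := gradient f b - gradient f a with hp
    have h1 := hconv a (b - L⁻¹ • p)
    have h2 := le_add_inner_gradient_add_sq hf hL b (b - L⁻¹ • p)
    have h3 : ⟪gradient f b, p⟫_ℝ - ⟪gradient f a, p⟫_ℝ = ‖p‖ ^ 2 := by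
      rw [← inner_sub_left, ← hp, real_inner_self_eq_norm_sq]
    rw [sub_sub_cancel_left, inner_neg_right, real_inner_smul_right, norm_neg, norm_smul,
      Real.norm_of_nonneg (inv_nonneg.2 hLpos.le)] at h2
    rw [sub_right_comm, inner_sub_right, real_inner_smul_right] at h1
    rw [norm_sub_rev, ← hp]
    have h4 : L⁻¹ * ‖p‖ ^ 2 - L / 2 * (L⁻¹ * ‖p‖) ^ 2 ≤
        f b - f a - ⟪gradient f a, b - a⟫_ℝ := by
      rw [← h3, mul_sub]
      linarith
    calc ‖p‖ ^ 2 = 2 * L * (L⁻¹ * ‖p‖ ^ 2 - L / 2 * (L⁻¹ * ‖p‖) ^ 2) := by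
          field_simp
          ring
      _ ≤ _ := by gcongr
  have h1 := key a b
  have h2 := key b a
  rw [norm_sub_rev] at h2
  have h3 : ⟪a - b, gradient f a - gradient f b⟫_ℝ =
      -⟪gradient f a, b - a⟫_ℝ - ⟪gradient f b, a - b⟫_ℝ := by
    rw [real_inner_comm, inner_sub_left, ← neg_sub a b, inner_neg_right]
    ring
  rw [h3]
  linarith

end Gradient

/-- Contraction for a curve `z'' = -g` started at rest, whose force `g` is strongly monotone and
cocoercive along `z`. -/
theorem norm_sq_le_of_second_order {E : Type*} [NormedAddCommGroup E] [InnerProductSpace ℝ E]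
    {μ L : ℝ} (hμ : 0 ≤ μ) (hμL : μ ≤ L) {z w g : ℝ → E}
    (hz : ∀ t, 0 ≤ t → HasDerivAt z (w t) t) (hw : ∀ t, 0 ≤ t → HasDerivAt w (-g t) t)
    (hg : ContinuousOn g (Set.Ici 0)) (hw0 : w 0 = 0)
    (hmono : ∀ t, 0 ≤ t → μ * ‖z t‖ ^ 2 ≤ ⟪z t, g t⟫_ℝ)
    (hcoco : ∀ t, 0 ≤ t → ‖g t‖ ^ 2 ≤ L * ⟪z t, g t⟫_ℝ)
    {T : ℝ} (hT : 0 ≤ T) (hLT : L * T ^ 2 ≤ 1 / 4) :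
    ‖z T‖ ^ 2 ≤ (1 - μ / 4 * T ^ 2) * ‖z 0‖ ^ 2 := by
  have hL : 0 ≤ L := hμ.trans hμL
  have hnonneg (t : ℝ) (ht : 0 ≤ t) : 0 ≤ ⟪z t, g t⟫_ℝ :=
    (mul_nonneg hμ (sq_nonneg _)).trans (hmono t ht)
  obtain ⟨H, hH0, hH⟩ : ∃ H : ℝ → ℝ, H 0 = 0 ∧ ∀ t, 0 ≤ t → HasDerivAt H ⟪z t, g t⟫_ℝ t := by
    have hzc : ContinuousOn z (Set.Ici 0) :=
      fun t ht => (hz t ht).continuousAt.continuousWithinAt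
    have hc : Continuous fun t : ℝ => ⟪z (max t 0), g (max t 0)⟫_ℝ :=
      (hzc.inner hg).comp_continuous (continuous_id.max continuous_const)
        fun t => le_max_right t 0
    refine ⟨fun t => ∫ s in (0 : ℝ)..t, ⟪z (max s 0), g (max s 0)⟫_ℝ, by simp, fun t ht => ?_⟩
    simpa [max_eq_left ht] using hc.integral_hasStrictDerivAt 0 t |>.hasDerivAt
  have hHnonneg (t : ℝ) (ht : 0 ≤ t) : 0 ≤ H t :=
    hH0 ▸ le_of_hasDerivAt_nonneg ht (fun s hs => hH s hs.1) fun s hs => hnonneg s hs.1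
  have hwH (t : ℝ) (ht : 0 ≤ t) : ‖w t‖ ^ 2 ≤ L * t * H t := by
    rcases ht.eq_or_lt with rfl | htpos
    · simp [hw0]
    have h := le_of_hasDerivAt_nonneg ht
      (F := fun s => t ^ 2 * L * H s + s * ‖w t‖ ^ 2 - 2 * t * ⟪w s, w t⟫_ℝ)
      (F' := fun s => t ^ 2 * L * ⟪z s, g s⟫_ℝ + ‖w t‖ ^ 2 + 2 * t * ⟪g s, w t⟫_ℝ)
      (fun s hs => by
        refine ((((hH s hs.1).const_mul _).add ((hasDerivAt_id s).mul_const _)).sub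
          (((hw s hs.1).inner ℝ (hasDerivAt_const s (w t))).const_mul (2 * t))).congr_deriv ?_
        simp)
      (fun s hs => by
        have h1 := norm_add_sq_real (t • g s) (w t)
        rw [norm_smul, Real.norm_of_nonneg ht, real_inner_smul_left] at h1
        nlinarith [sq_nonneg ‖t • g s + w t‖,
          mul_le_mul_of_nonneg_left (hcoco s hs.1) (sq_nonneg t)])
    simp only [hH0, hw0, inner_zero_left, real_inner_self_eq_norm_sq] at h
    refine le_of_mul_le_mul_left ?_ htpos
    linarith
  have hPderiv (t : ℝ) (ht : 0 ≤ t) :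
      HasDerivAt (fun s => ⟪z s, w s⟫_ℝ) (‖w t‖ ^ 2 - ⟪z t, g t⟫_ℝ) t := by
    refine ((hz t ht).inner ℝ (hw t ht)).congr_deriv ?_
    rw [inner_neg_right, real_inner_self_eq_norm_sq]
    ring
  have hDderiv (t : ℝ) (ht : 0 ≤ t) :
      HasDerivAt (fun s => ‖z s‖ ^ 2) (2 * ⟪z t, w t⟫_ℝ) t := (hz t ht).norm_sq
  have hP (t : ℝ) (ht : t ∈ Set.Icc 0 T) : ⟪z t, w t⟫_ℝ ≤ -(7 / 8) * H t := by
    have h := le_of_hasDerivAt_nonneg ht.1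
      (F := fun s => L / 2 * s ^ 2 * H s - H s - ⟪z s, w s⟫_ℝ)
      (F' := fun s => L * s * H s + L / 2 * s ^ 2 * ⟪z s, g s⟫_ℝ - ‖w s‖ ^ 2)
      (fun s hs => by
        refine (((((hasDerivAt_pow 2 s).const_mul (L / 2)).mul (hH s hs.1)).sub
          (hH s hs.1)).sub (hPderiv s hs.1)).congr_deriv ?_
        push_cast
        ring)
      (fun s hs => by
        have := hwH s hs.1
        have := mul_nonneg (mul_nonneg (half_pos zero_lt_one).le (mul_nonneg hL (sq_nonneg s)))
          (hnonneg s hs.1)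
        linarith)
    simp only [hH0, hw0, inner_zero_right] at h
    have hLt : L * t ^ 2 ≤ 1 / 4 :=
      (mul_le_mul_of_nonneg_left (pow_le_pow_left₀ ht.1 ht.2 2) hL).trans hLT
    nlinarith [mul_le_mul_of_nonneg_right hLt (hHnonneg t ht.1)]
  have hHD (t : ℝ) (ht : t ∈ Set.Icc 0 T) : μ * t * ‖z t‖ ^ 2 ≤ H t := by
    have h := le_of_hasDerivAt_nonneg ht.1
      (F := fun s => H s - μ * s * ‖z s‖ ^ 2)
      (F' := fun s => ⟪z s, g s⟫_ℝ - μ * ‖z s‖ ^ 2 - 2 * (μ * s) * ⟪z s, w s⟫_ℝ)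
      (fun s hs => by
        refine ((hH s hs.1).sub
          (((hasDerivAt_id s).const_mul μ).mul (hDderiv s hs.1))).congr_deriv ?_
        simp only [id]
        ring)
      (fun s hs => by
        have h1 := hP s ⟨hs.1, hs.2.trans ht.2⟩
        have h2 : ⟪z s, w s⟫_ℝ ≤ 0 := by linarith [hHnonneg s hs.1]
        linarith [hmono s hs.1, mul_nonpos_of_nonneg_of_nonpos (mul_nonneg hμ hs.1) h2])
    simp only [hH0] at h
    linarith
  have hR := le_of_hasDerivAt_nonneg hT
    (F := fun s => -((1 + 7 / 8 * μ * s ^ 2) * ‖z s‖ ^ 2))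
    (F' := fun s => -(7 / 4 * μ * s * ‖z s‖ ^ 2 + (1 + 7 / 8 * μ * s ^ 2) * (2 * ⟪z s, w s⟫_ℝ)))
    (fun s hs => by
      refine (((((hasDerivAt_pow 2 s).const_mul (7 / 8 * μ)).const_add 1).mul
        (hDderiv s hs.1)).neg).congr_deriv ?_
      push_cast
      ring)
    (fun s hs => by
      have h1 := hP s hs
      have h2 : ⟪z s, w s⟫_ℝ ≤ 0 := by linarith [hHnonneg s hs.1]
      have h3 := mul_nonpos_of_nonneg_of_nonpos (mul_nonneg hμ (sq_nonneg s)) h2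
      linarith [hHD s hs])
  have hμT : μ * T ^ 2 ≤ 1 / 4 := (mul_le_mul_of_nonneg_right hμL (sq_nonneg T)).trans hLT
  have hμT0 : 0 ≤ μ * T ^ 2 := mul_nonneg hμ (sq_nonneg T)
  have hcoef : 1 ≤ (1 - μ / 4 * T ^ 2) * (1 + 7 / 8 * μ * T ^ 2) := by nlinarith
  have hR' : (1 + 7 / 8 * μ * T ^ 2) * ‖z T‖ ^ 2 ≤ ‖z 0‖ ^ 2 := by simpa using hR
  calc ‖z T‖ ^ 2 ≤ (1 - μ / 4 * T ^ 2) * (1 + 7 / 8 * μ * T ^ 2) * ‖z T‖ ^ 2 :=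
        le_mul_of_one_le_left (sq_nonneg _) hcoef
    _ = (1 - μ / 4 * T ^ 2) * ((1 + 7 / 8 * μ * T ^ 2) * ‖z T‖ ^ 2) := mul_assoc _ _ _
    _ ≤ _ := mul_le_mul_of_nonneg_left hR' (by linarith)

/-- **Contraction bound for ideal HMC** (Lemma 1 of the paper).
If `f : ℝ^d → ℝ` is `μ`-strongly convex and `L`-smooth, and `x, y` are solutions of the
Hamiltonian ODE `x'' = -∇f(x)` (with velocities `u, v`) started with equal initial
velocities, then for all `0 ≤ t ≤ 1/(2√L)`,
`‖x(t) - y(t)‖² ≤ (1 - (μ/4)t²)‖x(0) - y(0)‖²`. -/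
theorem hmc_contraction {d : ℕ} (μ L : ℝ) (hμ : 0 < μ) (hμL : μ ≤ L)
    (f : EuclideanSpace ℝ (Fin d) → ℝ) (hf : ContDiff ℝ 1 f)
    (hstrong : ∀ a b : EuclideanSpace ℝ (Fin d),
      f b ≥ f a + ⟪gradient f a, b - a⟫_ℝ + μ / 2 * ‖b - a‖ ^ 2)
    (hsmooth : ∀ a b : EuclideanSpace ℝ (Fin d),
      ‖gradient f a - gradient f b‖ ≤ L * ‖a - b‖)
    (x y u v : ℝ → EuclideanSpace ℝ (Fin d))
    (hx : ∀ t, 0 ≤ t → HasDerivAt x (u t) t)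
    (hu : ∀ t, 0 ≤ t → HasDerivAt u (-gradient f (x t)) t)
    (hy : ∀ t, 0 ≤ t → HasDerivAt y (v t) t)
    (hv : ∀ t, 0 ≤ t → HasDerivAt v (-gradient f (y t)) t)
    (h0 : u 0 = v 0) :
    ∀ t, 0 ≤ t → t ≤ 1 / (2 * Real.sqrt L) →
      ‖x t - y t‖ ^ 2 ≤ (1 - μ / 4 * t ^ 2) * ‖x 0 - y 0‖ ^ 2 := by
  intro t ht htL
  have hL : 0 < L := hμ.trans_le hμL
  have hgrad : Continuous (gradient f) :=
    (LipschitzWith.of_dist_le_mul (K := ⟨L, hL.le⟩) fun a b => by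
      rw [dist_eq_norm, dist_eq_norm]
      exact hsmooth a b).continuous
  have hcont {c c' : ℝ → EuclideanSpace ℝ (Fin d)}
      (hc : ∀ t, 0 ≤ t → HasDerivAt c (c' t) t) :
      ContinuousOn (fun t => gradient f (c t)) (Set.Ici 0) :=
    hgrad.comp_continuousOn fun t ht => (hc t ht).continuousAt.continuousWithinAt
  refine norm_sq_le_of_second_order (z := fun t => x t - y t) (w := fun t => u t - v t)
    (g := fun t => gradient f (x t) - gradient f (y t)) hμ.le hμL
    (fun t ht => (hx t ht).sub (hy t ht)) (fun t ht => ?_) ((hcont hx).sub (hcont hy))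
    (sub_eq_zero.2 h0) (fun t _ => ?_) (fun t _ => ?_) ht ?_
  · exact ((hu t ht).sub (hv t ht)).congr_deriv (by abel)
  · have h1 := hstrong (x t) (y t)
    have h2 := hstrong (y t) (x t)
    rw [← neg_sub (x t) (y t), inner_neg_right, norm_neg] at h1
    rw [real_inner_comm, inner_sub_left]
    linarith
  · refine norm_gradient_sub_sq_le (hf.differentiable one_ne_zero) hL (fun a b => ?_) hsmooth _ _
    have := mul_nonneg (half_pos hμ).le (sq_nonneg ‖b - a‖)
    linarith [hstrong a b]
  · calc L * t ^ 2 ≤ L * (1 / (2 * √L)) ^ 2 := by gcongr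
      _ = 1 / 4 := by
        rw [div_pow, mul_pow, Real.sq_sqrt hL.le]
        field_simp
        norm_num
end

section
/- Let f : ℝ^d → ℝ be continuously differentiable and L-smooth. Let x, y : [0,∞) → ℝ^d be twice differentiable curves satisfying x''(t) = -∇f(x(t)) and y''(t) = -∇f(y(t)) with x'(0) = y'(0). Then for every t with 0 ≤ t ≤ 1/(2√L), one has (1/2)·‖x(0) - y(0)‖² ≤ ‖x(t) - y(t)‖² ≤ 2·‖x(0) - y(0)‖². -/
open Real
open scoped InnerProductSpace

/-- If `z'' = a` with `‖a‖ ≤ A` on `[0, T]` and `z'(0) = 0`, then `z` moves by at most `A T² / 2`. -/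
theorem norm_sub_le_of_norm_second_deriv_le {E : Type*} [NormedAddCommGroup E] [NormedSpace ℝ E]
    {z w a : ℝ → E} {A T : ℝ}
    (hz : ∀ t, 0 ≤ t → HasDerivAt z (w t) t) (hw : ∀ t, 0 ≤ t → HasDerivAt w (a t) t)
    (hw0 : w 0 = 0) (hA : ∀ t ∈ Set.Icc 0 T, ‖a t‖ ≤ A) {s : ℝ} (hs : s ∈ Set.Icc 0 T) :
    ‖z s - z 0‖ ≤ A * s ^ 2 / 2 := by
  have hwb : ∀ t ∈ Set.Icc 0 T, ‖w t‖ ≤ A * t := by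
    intro t ht
    have h := norm_image_sub_le_of_norm_deriv_le_segment'
      (fun r hr => (hw r hr.1).hasDerivWithinAt)
      (fun r hr => hA r ⟨hr.1, hr.2.le⟩) t ht
    simpa [hw0] using h
  refine image_norm_le_of_norm_deriv_right_le_deriv_boundary (f := fun r => z r - z 0)
    (f' := w) (B := fun r => A * r ^ 2 / 2) (B' := fun r => A * r)
    (fun r hr => ((hz r hr.1).sub_const _).continuousAt.continuousWithinAt)
    (fun r hr => ((hz r hr.1).sub_const _).hasDerivWithinAt) (by simp) (fun r => ?_)
    (fun r hr => hwb r ⟨hr.1, hr.2.le⟩) hs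
  have h := ((hasDerivAt_pow 2 r).const_mul A).div_const 2
  exact h.congr_deriv (by push_cast; ring)

/-- **Crude bound** (Claim 1 of the paper): if `f` is `L`-smooth and `x, y` solve the
Hamiltonian ODE `x'' = -∇f(x)` with equal initial velocities, then for `0 ≤ t ≤ 1/(2√L)`,
`(1/2)‖x(0) - y(0)‖² ≤ ‖x(t) - y(t)‖² ≤ 2‖x(0) - y(0)‖²`. -/
theorem hmc_crude_bound {d : ℕ} (L : ℝ) (hL : 0 < L)
    (f : EuclideanSpace ℝ (Fin d) → ℝ) (hf : ContDiff ℝ 1 f)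
    (hsmooth : ∀ a b : EuclideanSpace ℝ (Fin d),
      ‖gradient f a - gradient f b‖ ≤ L * ‖a - b‖)
    (x y u v : ℝ → EuclideanSpace ℝ (Fin d))
    (hx : ∀ t, 0 ≤ t → HasDerivAt x (u t) t)
    (hu : ∀ t, 0 ≤ t → HasDerivAt u (-gradient f (x t)) t)
    (hy : ∀ t, 0 ≤ t → HasDerivAt y (v t) t)
    (hv : ∀ t, 0 ≤ t → HasDerivAt v (-gradient f (y t)) t)
    (h0 : u 0 = v 0) :
    ∀ t, 0 ≤ t → t ≤ 1 / (2 * Real.sqrt L) →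
      1 / 2 * ‖x 0 - y 0‖ ^ 2 ≤ ‖x t - y t‖ ^ 2 ∧
      ‖x t - y t‖ ^ 2 ≤ 2 * ‖x 0 - y 0‖ ^ 2 := by
  intro t ht0 ht
  have hz : ∀ s, 0 ≤ s → HasDerivAt (fun r => x r - y r) (u s - v s) s :=
    fun s hs => (hx s hs).sub (hy s hs)
  have hw : ∀ s, 0 ≤ s → HasDerivAt (fun r => u r - v r)
      (-gradient f (x s) - -gradient f (y s)) s :=
    fun s hs => (hu s hs).sub (hv s hs)
  have hcont : ContinuousOn (fun r => ‖x r - y r‖) (Set.Icc 0 t) :=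
    fun r hr => (hz r hr.1).continuousAt.norm.continuousWithinAt
  obtain ⟨m, hm, hmax⟩ := isCompact_Icc.exists_isMaxOn ⟨0, Set.left_mem_Icc.2 ht0⟩ hcont
  set M := ‖x m - y m‖
  have hacc : ∀ s ∈ Set.Icc 0 t, ‖-gradient f (x s) - -gradient f (y s)‖ ≤ L * M := by
    intro s hs
    rw [neg_sub_neg, norm_sub_rev]
    exact (hsmooth _ _).trans (mul_le_mul_of_nonneg_left (hmax hs) hL.le)
  have hLt : L * t ^ 2 ≤ 1 / 4 := by
    have hsq : 0 < √L := Real.sqrt_pos.2 hL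
    rw [le_div_iff₀ (by positivity)] at ht
    have h : (t * (2 * √L)) ^ 2 ≤ 1 := pow_le_one₀ (by positivity) ht
    rw [mul_pow, mul_pow, Real.sq_sqrt hL.le] at h
    linarith
  have hdisp : ∀ s ∈ Set.Icc 0 t, ‖x s - y s - (x 0 - y 0)‖ ≤ M / 8 := by
    intro s hs
    have h := norm_sub_le_of_norm_second_deriv_le hz hw (by simp [h0]) hacc hs
    have hLs : L * s ^ 2 ≤ 1 / 4 :=
      (mul_le_mul_of_nonneg_left (pow_le_pow_left₀ hs.1 hs.2 2) hL.le).trans hLt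
    have hM := mul_le_mul_of_nonneg_left hLs (norm_nonneg (x m - y m))
    linarith
  have hM : M ≤ ‖x 0 - y 0‖ + M / 8 := by
    linarith [norm_sub_norm_le (x m - y m) (x 0 - y 0), hdisp m hm]
  have ht' := hdisp t ⟨ht0, le_rfl⟩
  have hupper := norm_sub_norm_le (x t - y t) (x 0 - y 0)
  have hlower := norm_sub_norm_le (x 0 - y 0) (x t - y t)
  rw [norm_sub_rev (x 0 - y 0)] at hlower
  have h1 : 6 / 7 * ‖x 0 - y 0‖ ≤ ‖x t - y t‖ := by linarith
  have h2 : ‖x t - y t‖ ≤ 8 / 7 * ‖x 0 - y 0‖ := by linarith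
  have h3 := pow_le_pow_left₀ (by positivity) h1 2
  have h4 := pow_le_pow_left₀ (norm_nonneg _) h2 2
  constructor <;> nlinarith [sq_nonneg ‖x 0 - y 0‖]
end

section
/- Let f : ℝ^d → ℝ be continuously differentiable and L-smooth. Let x, y : [0,∞) → ℝ^d be twice differentiable curves satisfying x''(t) = -∇f(x(t)) and y''(t) = -∇f(y(t)) with x'(0) = y'(0). Then for every t ≥ 0, one has ‖x(t) - y(t)‖ ≤ cosh(√L · t)·‖x(0) - y(0)‖. -/
open Real
open scoped InnerProductSpace

/-- A curve that starts at norm at most `B 0` and whose speed is at most `B'` on `[0, T]` has norm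
at most `B` on `[0, T]`. -/
theorem norm_le_of_norm_hasDerivAt_le {E : Type*} [NormedAddCommGroup E] [NormedSpace ℝ E]
    {T : ℝ} {z w : ℝ → E} {B B' : ℝ → ℝ}
    (hz : ∀ t, 0 ≤ t → HasDerivAt z (w t) t) (hB : ∀ t, HasDerivAt B (B' t) t)
    (h0 : ‖z 0‖ ≤ B 0) (hbound : ∀ t ∈ Set.Icc 0 T, ‖w t‖ ≤ B' t) :
    ∀ t ∈ Set.Icc 0 T, ‖z t‖ ≤ B t :=
  fun _ ht => image_norm_le_of_norm_deriv_right_le_deriv_boundary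
    (fun t ht => (hz t ht.1).continuousAt.continuousWithinAt)
    (fun t ht => (hz t ht.1).hasDerivWithinAt) h0 hB
    (fun t ht => hbound t ⟨ht.1, ht.2.le⟩) ht

/-- If `‖z''‖ ≤ k² ‖z‖` and `z'(0) = 0`, then `‖z(t)‖ ≤ cosh (k t) ‖z(0)‖` for `t ≥ 0`. -/
theorem norm_le_cosh_mul_of_norm_deriv_deriv_le {E : Type*} [NormedAddCommGroup E]
    [NormedSpace ℝ E] {k : ℝ} {z w a : ℝ → E}
    (hz : ∀ t, 0 ≤ t → HasDerivAt z (w t) t) (hw : ∀ t, 0 ≤ t → HasDerivAt w (a t) t)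
    (ha : ∀ t, 0 ≤ t → ‖a t‖ ≤ k ^ 2 * ‖z t‖) (h0 : w 0 = 0) {T : ℝ} (hT : 0 ≤ T) :
    ‖z T‖ ≤ Real.cosh (k * T) * ‖z 0‖ := by
  have hlin (t : ℝ) : HasDerivAt (fun s : ℝ => k * s) k t := by
    simpa using (hasDerivAt_id t).const_mul k
  -- Let `C` be the maximum over `[0, T]` of the ratio `‖z s‖ / cosh (k s)`.
  obtain ⟨s, hs, hmax⟩ := isCompact_Icc.exists_isMaxOn (Set.nonempty_Icc.2 hT)
    (f := fun t => ‖z t‖ / Real.cosh (k * t)) fun t ht =>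
      (ContinuousAt.div (g := fun t => Real.cosh (k * t)) (hz t ht.1).continuousAt.norm (by fun_prop)
        (Real.cosh_pos _).ne').continuousWithinAt
  set C := ‖z s‖ / Real.cosh (k * s)
  have hzC : ∀ t ∈ Set.Icc 0 T, ‖z t‖ ≤ C * Real.cosh (k * t) := fun t ht =>
    (div_le_iff₀ (Real.cosh_pos _)).1 (hmax ht)
  have hwC : ∀ t ∈ Set.Icc 0 T, ‖w t‖ ≤ C * k * Real.sinh (k * t) := by
    refine norm_le_of_norm_hasDerivAt_le (B' := fun t => C * k * (Real.cosh (k * t) * k)) hw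
      (fun t => (hlin t).sinh.const_mul _) (by simp [h0]) fun t ht => ?_
    calc ‖a t‖ ≤ k ^ 2 * ‖z t‖ := ha t ht.1
      _ ≤ k ^ 2 * (C * Real.cosh (k * t)) := by gcongr; exact hzC t ht
      _ = C * k * (Real.cosh (k * t) * k) := by ring
  have hzC' : ∀ t ∈ Set.Icc 0 T, ‖z t‖ ≤ C * Real.cosh (k * t) - (C - ‖z 0‖) :=
    norm_le_of_norm_hasDerivAt_le (B' := fun t => C * (Real.sinh (k * t) * k)) hz
      (fun t => ((hlin t).cosh.const_mul _).sub_const _) (by simp)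
      fun t ht => (hwC t ht).trans_eq (by ring)
  -- Evaluating the improved bound at the maximizer `s` forces `C ≤ ‖z 0‖`.
  have hCs : C * Real.cosh (k * s) = ‖z s‖ := div_mul_cancel₀ _ (Real.cosh_pos _).ne'
  have hCle : C ≤ ‖z 0‖ := by linarith [hzC' s hs]
  calc ‖z T‖ ≤ C * Real.cosh (k * T) := hzC T ⟨hT, le_rfl⟩
    _ ≤ ‖z 0‖ * Real.cosh (k * T) := by gcongr
    _ = Real.cosh (k * T) * ‖z 0‖ := mul_comm _ _

/-- If `f` is `L`-smooth and `x, y` solve the Hamiltonian ODE `x'' = -∇f(x)` with equal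
initial velocities, then `‖x(t) - y(t)‖ ≤ cosh(√L·t)·‖x(0) - y(0)‖` for all `t ≥ 0`. -/
theorem hmc_cosh_upper_bound {d : ℕ} (L : ℝ) (hL : 0 < L)
    (f : EuclideanSpace ℝ (Fin d) → ℝ) (hf : ContDiff ℝ 1 f)
    (hsmooth : ∀ a b : EuclideanSpace ℝ (Fin d),
      ‖gradient f a - gradient f b‖ ≤ L * ‖a - b‖)
    (x y u v : ℝ → EuclideanSpace ℝ (Fin d))
    (hx : ∀ t, 0 ≤ t → HasDerivAt x (u t) t)
    (hu : ∀ t, 0 ≤ t → HasDerivAt u (-gradient f (x t)) t)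
    (hy : ∀ t, 0 ≤ t → HasDerivAt y (v t) t)
    (hv : ∀ t, 0 ≤ t → HasDerivAt v (-gradient f (y t)) t)
    (h0 : u 0 = v 0) :
    ∀ t, 0 ≤ t →
      ‖x t - y t‖ ≤ Real.cosh (Real.sqrt L * t) * ‖x 0 - y 0‖ := by
  intro t ht
  refine norm_le_cosh_mul_of_norm_deriv_deriv_le (z := fun t => x t - y t)
    (fun t ht => (hx t ht).sub (hy t ht)) (fun t ht => (hu t ht).sub (hv t ht))
    (fun t _ => ?_) (sub_eq_zero.2 h0) ht
  rw [Real.sq_sqrt hL.le, neg_sub_neg, norm_sub_rev]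
  exact hsmooth (x t) (y t)
end

section
/- Let f : ℝ^d → ℝ be continuously differentiable and L-smooth. Let x, y : [0,∞) → ℝ^d be twice differentiable curves satisfying x''(t) = -∇f(x(t)) and y''(t) = -∇f(y(t)) with x'(0) = y'(0). Then for every t with 0 ≤ t ≤ 1/(2√L), one has ‖x(t) - y(t)‖ ≥ (2 - cosh(√L · t))·‖x(0) - y(0)‖; in particular ‖x(t) - y(t)‖ ≥ (1/√2)·‖x(0) - y(0)‖. -/
open Real
open scoped InnerProductSpace

section SecondOrderComparison

variable {E : Type*} [NormedAddCommGroup E] [NormedSpace ℝ E]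
  {w p g : ℝ → E} {s T : ℝ}

/-- If `w` has derivative `p`, `p` has derivative `g`, `p 0 = 0` and `‖g‖ ≤ s² m cosh (s t)` on `[0, T]`, then the displacement
`w - w 0` is at most `m (cosh (s t) - 1)`. -/
theorem norm_sub_le_mul_cosh_sub_one {m : ℝ}
    (hw : ∀ t, 0 ≤ t → HasDerivAt w (p t) t) (hp : ∀ t, 0 ≤ t → HasDerivAt p (g t) t)
    (hp0 : p 0 = 0) (hg : ∀ t ∈ Set.Icc 0 T, ‖g t‖ ≤ s ^ 2 * (m * cosh (s * t))) :
    ∀ t ∈ Set.Icc 0 T, ‖w t - w 0‖ ≤ m * (cosh (s * t) - 1) := by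
  have hlin : ∀ t : ℝ, HasDerivAt (fun r : ℝ => s * r) s t := fun t => by
    simpa using (hasDerivAt_id t).const_mul s
  have hpb : ∀ t ∈ Set.Icc 0 T, ‖p t‖ ≤ m * s * sinh (s * t) := by
    intro t ht
    refine image_norm_le_of_norm_deriv_right_le_deriv_boundary (f' := g)
      (B := fun t => m * s * sinh (s * t)) (B' := fun t => s ^ 2 * (m * cosh (s * t)))
      (fun r hr => (hp r hr.1).continuousAt.continuousWithinAt)
      (fun r hr => (hp r hr.1).hasDerivWithinAt) (by simp [hp0])
      (fun r => ?_) (fun r hr => hg r ⟨hr.1, hr.2.le⟩) ht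
    exact ((hlin r).sinh.const_mul (m * s)).congr_deriv (by ring)
  intro t ht
  refine image_norm_le_of_norm_deriv_right_le_deriv_boundary (f := fun r => w r - w 0) (f' := p)
    (B := fun t => m * (cosh (s * t) - 1)) (B' := fun t => m * s * sinh (s * t))
    (fun r hr => ((hw r hr.1).sub_const (w 0)).continuousAt.continuousWithinAt)
    (fun r hr => ((hw r hr.1).sub_const (w 0)).hasDerivWithinAt) (by simp)
    (fun r => ?_) (fun r hr => hpb r ⟨hr.1, hr.2.le⟩) ht
  exact (((hlin r).cosh.sub_const 1).const_mul m).congr_deriv (by ring)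

/-- If `w` has derivative `p`, `p` has derivative `g`, `p 0 = 0` and `‖g‖ ≤ s² ‖w‖`, then `w` stays within
`(cosh (s t) - 1) ‖w 0‖` of its initial value. -/
theorem norm_sub_le_cosh_sub_one_mul_norm
    (hw : ∀ t, 0 ≤ t → HasDerivAt w (p t) t) (hp : ∀ t, 0 ≤ t → HasDerivAt p (g t) t)
    (hp0 : p 0 = 0) (hg : ∀ t, 0 ≤ t → ‖g t‖ ≤ s ^ 2 * ‖w t‖) (hT : 0 ≤ T) :
    ‖w T - w 0‖ ≤ (cosh (s * T) - 1) * ‖w 0‖ := by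
  have hcont : ContinuousOn (fun t => ‖w t‖ / cosh (s * t)) (Set.Icc 0 T) := by
    refine ContinuousOn.div
      (fun r hr => (hw r hr.1).continuousAt.continuousWithinAt.norm) ?_
      (fun r _ => (cosh_pos _).ne')
    exact (continuous_cosh.comp (continuous_const.mul continuous_id)).continuousOn
  obtain ⟨a, ha, hmax⟩ := isCompact_Icc.exists_isMaxOn (Set.nonempty_Icc.2 hT) hcont
  set m := ‖w a‖ / cosh (s * a) with hm
  have hbound : ∀ t ∈ Set.Icc 0 T, ‖w t‖ ≤ m * cosh (s * t) := fun t ht =>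
    (div_le_iff₀ (cosh_pos _)).1 (hmax ht)
  have hdisp := norm_sub_le_mul_cosh_sub_one (m := m) hw hp hp0 fun t ht =>
    (hg t ht.1).trans (mul_le_mul_of_nonneg_left (hbound t ht) (sq_nonneg s))
  have hma : ‖w a‖ = m * cosh (s * a) := by
    rw [hm, div_mul_cancel₀ _ (cosh_pos _).ne']
  have hm0 : m ≤ ‖w 0‖ := by
    have h1 := hdisp a ha
    have h2 := norm_sub_norm_le (w a) (w 0)
    linarith
  have hT' := hdisp T ⟨hT, le_rfl⟩
  have hcosh := one_le_cosh (s * T)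
  calc ‖w T - w 0‖ ≤ m * (cosh (s * T) - 1) := hT'
    _ ≤ ‖w 0‖ * (cosh (s * T) - 1) := mul_le_mul_of_nonneg_right hm0 (by linarith)
    _ = (cosh (s * T) - 1) * ‖w 0‖ := mul_comm _ _

end SecondOrderComparison

theorem inv_sqrt_two_le_two_sub_cosh {r : ℝ} (h0 : 0 ≤ r) (hr : r ≤ 1 / 2) :
    1 / √2 ≤ 2 - cosh r := by
  have h1 : cosh r ≤ 8 / 7 :=
    calc cosh r ≤ exp (r ^ 2 / 2) := cosh_le_exp_half_sq r
      _ ≤ exp (1 / 8) := exp_le_exp.2 (by nlinarith)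
      _ ≤ 1 / (1 - 1 / 8) := exp_bound_div_one_sub_of_interval (by norm_num) (by norm_num)
      _ = 8 / 7 := by norm_num
  have h2 : 7 / 6 ≤ √2 := le_sqrt_of_sq_le (by norm_num)
  have h3 : 1 / √2 ≤ 6 / 7 := by
    rw [div_le_iff₀ (by linarith)]
    linarith
  linarith

/-- If `f` is `L`-smooth and `x, y` solve the Hamiltonian ODE `x'' = -∇f(x)` with equal
initial velocities, then for `0 ≤ t ≤ 1/(2√L)`,
`‖x(t) - y(t)‖ ≥ (2 - cosh(√L·t))·‖x(0) - y(0)‖ ≥ (1/√2)·‖x(0) - y(0)‖`. -/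
theorem hmc_lower_bound {d : ℕ} (L : ℝ) (hL : 0 < L)
    (f : EuclideanSpace ℝ (Fin d) → ℝ) (hf : ContDiff ℝ 1 f)
    (hsmooth : ∀ a b : EuclideanSpace ℝ (Fin d),
      ‖gradient f a - gradient f b‖ ≤ L * ‖a - b‖)
    (x y u v : ℝ → EuclideanSpace ℝ (Fin d))
    (hx : ∀ t, 0 ≤ t → HasDerivAt x (u t) t)
    (hu : ∀ t, 0 ≤ t → HasDerivAt u (-gradient f (x t)) t)
    (hy : ∀ t, 0 ≤ t → HasDerivAt y (v t) t)
    (hv : ∀ t, 0 ≤ t → HasDerivAt v (-gradient f (y t)) t)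
    (h0 : u 0 = v 0) :
    ∀ t, 0 ≤ t → t ≤ 1 / (2 * Real.sqrt L) →
      (2 - Real.cosh (Real.sqrt L * t)) * ‖x 0 - y 0‖ ≤ ‖x t - y t‖ ∧
      1 / Real.sqrt 2 * ‖x 0 - y 0‖ ≤ ‖x t - y t‖ := by
  intro t ht htL
  have hs : 0 < √L := sqrt_pos.2 hL
  have hdisp := norm_sub_le_cosh_sub_one_mul_norm (w := fun t => x t - y t) (s := √L)
    (fun t ht => (hx t ht).sub (hy t ht)) (fun t ht => (hu t ht).sub (hv t ht))
    (by simp [h0])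
    (fun t _ => by
      rw [sq_sqrt hL.le, neg_sub_neg, norm_sub_rev]
      exact hsmooth (x t) (y t)) ht
  have htri := norm_sub_norm_le (x 0 - y 0) (x t - y t)
  rw [norm_sub_rev (x 0 - y 0) (x t - y t)] at htri
  have hmain : (2 - cosh (√L * t)) * ‖x 0 - y 0‖ ≤ ‖x t - y t‖ := by linarith
  refine ⟨hmain, le_trans (mul_le_mul_of_nonneg_right ?_ (norm_nonneg _)) hmain⟩
  refine inv_sqrt_two_le_two_sub_cosh (by positivity) ?_
  calc √L * t ≤ √L * (1 / (2 * √L)) := mul_le_mul_of_nonneg_left htL hs.le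
    _ = 1 / 2 := by field_simp
end

section
/- Let f : ℝ^d → ℝ be continuously differentiable and L-smooth. Let x, y : [0,∞) → ℝ^d be twice differentiable curves satisfying x''(t) = -∇f(x(t)) and y''(t) = -∇f(y(t)) with x'(0) = y'(0). Then for every t ≥ 0, the velocity difference satisfies ‖x'(t) - y'(t)‖ ≤ L · ∫₀ᵗ ‖x(s) - y(s)‖ ds. In particular, for 0 ≤ t ≤ 1/(2√L), one has ‖x'(t) - y'(t)‖ ≤ √L · sinh(√L · t) · ‖x(0) - y(0)‖. -/
open Real MeasureTheory
open scoped InnerProductSpace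

/-- A function with `φ' ≤ c φ` on `[0, ∞)` and `φ 0 ≤ 0` is nonpositive on `[0, ∞)`. -/
lemma nonpos_of_hasDerivAt_le_mul {φ φ' : ℝ → ℝ} {c : ℝ}
    (hφ : ∀ t, 0 ≤ t → HasDerivAt φ (φ' t) t) (hle : ∀ t, 0 ≤ t → φ' t ≤ c * φ t)
    (h0 : φ 0 ≤ 0) {t : ℝ} (ht : 0 ≤ t) : φ t ≤ 0 := by
  have hd : ∀ s, 0 ≤ s → HasDerivAt (fun s => Real.exp (-c * s) * φ s)
      (Real.exp (-c * s) * (φ' s - c * φ s)) s := fun s hs => by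
    have he := ((hasDerivAt_id s).const_mul (-c)).exp
    refine (he.mul (hφ s hs)).congr_deriv ?_
    simp only [id]
    ring
  have hanti : AntitoneOn (fun s => Real.exp (-c * s) * φ s) (Set.Ici 0) := by
    refine antitoneOn_of_deriv_nonpos (convex_Ici 0)
      (fun s hs => (hd s hs).continuousAt.continuousWithinAt) ?_ ?_
    · intro s hs
      exact (hd s (interior_subset hs)).differentiableAt.differentiableWithinAt
    · intro s hs
      have hs : 0 ≤ s := interior_subset (s := Set.Ici (0 : ℝ)) hs
      rw [(hd s hs).deriv]
      exact mul_nonpos_of_nonneg_of_nonpos (Real.exp_pos _).le (by linarith [hle s hs])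
  have h := hanti Set.self_mem_Ici ht ht
  simp only [mul_zero, Real.exp_zero, one_mul] at h
  exact nonpos_of_mul_nonpos_right (h.trans h0) (Real.exp_pos _)

/-- A curve whose speed is at most `g` moves by at most the integral of `g`. -/
lemma norm_sub_le_integral_of_norm_hasDerivAt_le {E : Type*} [NormedAddCommGroup E]
    [NormedSpace ℝ E] {w w' : ℝ → E} {g : ℝ → ℝ} (hg : Continuous g)
    (hw : ∀ t, 0 ≤ t → HasDerivAt w (w' t) t) (hle : ∀ t, 0 ≤ t → ‖w' t‖ ≤ g t)
    {t : ℝ} (ht : 0 ≤ t) : ‖w t - w 0‖ ≤ ∫ s in (0:ℝ)..t, g s :=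
  image_norm_le_of_norm_deriv_right_le_deriv_boundary (a := 0) (b := t)
    (f := fun s => w s - w 0) (f' := w') (B := fun r => ∫ s in (0:ℝ)..r, g s) (B' := g)
    (fun s hs => ((hw s hs.1).continuousAt.sub continuousAt_const).continuousWithinAt)
    (fun s hs => ((hw s hs.1).sub_const (w 0)).hasDerivWithinAt)
    (by simp)
    (fun s => intervalIntegral.integral_hasDerivAt_right (hg.intervalIntegrable _ _)
      hg.aestronglyMeasurable.stronglyMeasurableAtFilter hg.continuousAt)
    (fun s hs => hle s hs.1) (Set.right_mem_Icc.2 ht)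

/-- If `a ≤ a₀ + ∫ b` and `b ≤ k² ∫ a` on `[0, ∞)`, then `b ≤ k sinh(k t) a₀`. -/
lemma le_sinh_of_le_integral {a b : ℝ → ℝ} (ha : Continuous a) (hb : Continuous b)
    {k a₀ : ℝ} (hk : 0 < k)
    (hab : ∀ t, 0 ≤ t → a t ≤ a₀ + ∫ s in (0:ℝ)..t, b s)
    (hba : ∀ t, 0 ≤ t → b t ≤ k ^ 2 * ∫ s in (0:ℝ)..t, a s) {t : ℝ} (ht : 0 ≤ t) :
    b t ≤ k * Real.sinh (k * t) * a₀ := by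
  set A : ℝ → ℝ := fun t => ∫ s in (0:ℝ)..t, a s with hA
  set B : ℝ → ℝ := fun t => ∫ s in (0:ℝ)..t, b s with hB
  have dA : ∀ t, HasDerivAt A (a t) t := fun t =>
    intervalIntegral.integral_hasDerivAt_right (ha.intervalIntegrable _ _)
      ha.aestronglyMeasurable.stronglyMeasurableAtFilter ha.continuousAt
  have dB : ∀ t, HasDerivAt B (b t) t := fun t =>
    intervalIntegral.integral_hasDerivAt_right (hb.intervalIntegrable _ _)
      hb.aestronglyMeasurable.stronglyMeasurableAtFilter hb.continuousAt
  have A0 : A 0 = 0 := by simp [hA]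
  have B0 : B 0 = 0 := by simp [hB]
  have dk : ∀ t, HasDerivAt (fun t => k * t) k t := fun t => by
    simpa using (hasDerivAt_id t).const_mul k
  have dα : ∀ t, HasDerivAt (fun t => k * A t - a₀ * Real.sinh (k * t))
      (k * a t - a₀ * (Real.cosh (k * t) * k)) t := fun t =>
    ((dA t).const_mul k).sub ((dk t).sinh.const_mul a₀)
  have dβ : ∀ t, HasDerivAt (fun t => B t + a₀ - a₀ * Real.cosh (k * t))
      (b t - a₀ * (Real.sinh (k * t) * k)) t := fun t =>
    ((dB t).add_const a₀).sub ((dk t).cosh.const_mul a₀)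
  have hαβ : ∀ t, 0 ≤ t →
      (k * A t - a₀ * Real.sinh (k * t)) + (B t + a₀ - a₀ * Real.cosh (k * t)) ≤ 0 :=
    fun t ht => nonpos_of_hasDerivAt_le_mul (c := k) (fun s _ => (dα s).add (dβ s))
      (fun s hs => by
        have h1 := mul_le_mul_of_nonneg_left (hab s hs) hk.le
        have h2 := hba s hs
        simp only [Pi.add_apply]
        linarith) (by simp [A0, B0]) ht
  have hα : k * A t - a₀ * Real.sinh (k * t) ≤ 0 :=
    nonpos_of_hasDerivAt_le_mul (c := -k) (fun s _ => dα s)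
      (fun s hs => by
        have h1 := mul_le_mul_of_nonneg_left (hab s hs) hk.le
        have h2 := mul_le_mul_of_nonneg_left (hαβ s hs) hk.le
        linarith) (by simp [A0]) ht
  have h1 := hba t ht
  have h2 := mul_le_mul_of_nonneg_left hα hk.le
  linarith

/-- If `f` is `L`-smooth and `x, y` solve the Hamiltonian ODE `x'' = -∇f(x)` with equal
initial velocities `u, v`, then `‖x'(t) - y'(t)‖ ≤ L·∫₀ᵗ ‖x(s) - y(s)‖ ds` for all `t ≥ 0`,
and `‖x'(t) - y'(t)‖ ≤ √L·sinh(√L·t)·‖x(0) - y(0)‖` for `0 ≤ t ≤ 1/(2√L)`. -/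
theorem hmc_velocity_bound {d : ℕ} (L : ℝ) (hL : 0 < L)
    (f : EuclideanSpace ℝ (Fin d) → ℝ) (hf : ContDiff ℝ 1 f)
    (hsmooth : ∀ a b : EuclideanSpace ℝ (Fin d),
      ‖gradient f a - gradient f b‖ ≤ L * ‖a - b‖)
    (x y u v : ℝ → EuclideanSpace ℝ (Fin d))
    (hx : ∀ t, 0 ≤ t → HasDerivAt x (u t) t)
    (hu : ∀ t, 0 ≤ t → HasDerivAt u (-gradient f (x t)) t)
    (hy : ∀ t, 0 ≤ t → HasDerivAt y (v t) t)
    (hv : ∀ t, 0 ≤ t → HasDerivAt v (-gradient f (y t)) t)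
    (h0 : u 0 = v 0) :
    (∀ t, 0 ≤ t → ‖u t - v t‖ ≤ L * ∫ s in (0:ℝ)..t, ‖x s - y s‖) ∧
    (∀ t, 0 ≤ t → t ≤ 1 / (2 * Real.sqrt L) →
      ‖u t - v t‖ ≤ Real.sqrt L * Real.sinh (Real.sqrt L * t) * ‖x 0 - y 0‖) := by
  set a : ℝ → ℝ := fun t => ‖x (max t 0) - y (max t 0)‖ with ha_def
  set b : ℝ → ℝ := fun t => ‖u (max t 0) - v (max t 0)‖ with hb_def
  have hmax : Continuous fun t : ℝ => max t 0 := by fun_prop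
  have ha : Continuous a := continuous_iff_continuousAt.2 fun t =>
    (((hx _ (le_max_right t 0)).sub (hy _ (le_max_right t 0))).continuousAt.comp
      (f := fun t : ℝ => max t 0) hmax.continuousAt).norm
  have hb : Continuous b := continuous_iff_continuousAt.2 fun t =>
    (((hu _ (le_max_right t 0)).sub (hv _ (le_max_right t 0))).continuousAt.comp
      (f := fun t : ℝ => max t 0) hmax.continuousAt).norm
  have ha_eq : ∀ t, 0 ≤ t → a t = ‖x t - y t‖ := fun t ht => by simp [ha_def, max_eq_left ht]
  have hb_eq : ∀ t, 0 ≤ t → b t = ‖u t - v t‖ := fun t ht => by simp [hb_def, max_eq_left ht]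
  have hvel : ∀ t, 0 ≤ t → ‖u t - v t‖ ≤ L * ∫ s in (0:ℝ)..t, a s := fun t ht => by
    have h := norm_sub_le_integral_of_norm_hasDerivAt_le (ha.const_mul L)
      (fun s hs => (hu s hs).sub (hv s hs)) (fun s hs => by
        rw [ha_eq s hs, neg_sub_neg, norm_sub_rev]
        exact hsmooth _ _) ht
    simpa [h0] using h
  have hpos : ∀ t, 0 ≤ t → a t ≤ ‖x 0 - y 0‖ + ∫ s in (0:ℝ)..t, b s := fun t ht => by
    have h := norm_sub_le_integral_of_norm_hasDerivAt_le hb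
      (fun s hs => (hx s hs).sub (hy s hs)) (fun s hs => (hb_eq s hs).ge) ht
    rw [ha_eq t ht]
    exact (norm_le_norm_add_norm_sub' _ _).trans (add_le_add le_rfl h)
  refine ⟨fun t ht => ?_, fun t ht _ => ?_⟩
  · refine (hvel t ht).trans_eq ?_
    congr 1
    refine intervalIntegral.integral_congr fun s hs => ha_eq s ?_
    rw [Set.uIcc_of_le ht] at hs
    exact hs.1
  · rw [← hb_eq t ht]
    refine le_sinh_of_le_integral ha hb (Real.sqrt_pos.2 hL) hpos (fun s hs => ?_) ht
    rw [Real.sq_sqrt hL.le, hb_eq s hs]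
    exact hvel s hs
end

section
/- Let f : ℝ^d → ℝ be μ-strongly convex, convex, and L-smooth. Let x, y : [0,∞) → ℝ^d be twice differentiable curves satisfying x''(t) = -∇f(x(t)) and y''(t) = -∇f(y(t)) with x'(0) = y'(0) and x(0) ≠ y(0). Define ρ(s) = ⟨∇f(x(s)) - ∇f(y(s)), x(s) - y(s)⟩ / ‖x(s) - y(s)‖². Then for every t with 0 ≤ t ≤ 1/(2√L), one has ‖x'(t) - y'(t)‖² ≤ 2·L·t·(∫₀ᵗ ρ(s) ds)·‖x(0) - y(0)‖². -/
open Real MeasureTheory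
open scoped InnerProductSpace

section Gradient

variable {F : Type*} [NormedAddCommGroup F] [InnerProductSpace ℝ F] [CompleteSpace F]

/-- The descent lemma for functions with Lipschitz gradient. -/
lemma le_add_inner_gradient_add_sq_of_lipschitz {f : F → ℝ} {L : ℝ} (hf : Differentiable ℝ f)
    (hsmooth : ∀ a b, ‖gradient f a - gradient f b‖ ≤ L * ‖a - b‖) (a b : F) :
    f b ≤ f a + ⟪gradient f a, b - a⟫_ℝ + L / 2 * ‖b - a‖ ^ 2 := by
  set h := b - a with hh
  have hφ : ∀ s : ℝ, HasDerivAt (fun s : ℝ => f (a + s • h)) ⟪gradient f (a + s • h), h⟫_ℝ s := by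
    intro s
    have h1 : HasDerivAt (fun s : ℝ => a + s • h) h s := by
      simpa using ((hasDerivAt_id s).smul_const h).const_add a
    exact (hf (a + s • h)).hasGradientAt.hasFDerivAt.comp_hasDerivAt s h1
  have hB : ∀ s : ℝ, HasDerivAt
      (fun s : ℝ => f a + s * ⟪gradient f a, h⟫_ℝ + L / 2 * ‖h‖ ^ 2 * s ^ 2)
      (⟪gradient f a, h⟫_ℝ + L * s * ‖h‖ ^ 2) s := by
    intro s
    refine ((((hasDerivAt_id s).mul_const ⟪gradient f a, h⟫_ℝ).const_add (f a)).add
      ((hasDerivAt_pow 2 s).const_mul (L / 2 * ‖h‖ ^ 2))).congr_deriv ?_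
    push_cast
    ring
  have key := image_le_of_deriv_right_le_deriv_boundary (a := (0 : ℝ)) (b := 1)
    (fun s _ => (hφ s).continuousAt.continuousWithinAt)
    (fun s _ => (hφ s).hasDerivWithinAt) (by simp)
    (fun s _ => (hB s).continuousAt.continuousWithinAt)
    (fun s _ => (hB s).hasDerivWithinAt)
    (fun s hs => by
      have h1 := real_inner_le_norm (gradient f (a + s • h) - gradient f a) h
      have h2 := hsmooth (a + s • h) a
      rw [add_sub_cancel_left, norm_smul, norm_of_nonneg hs.1] at h2
      rw [inner_sub_left] at h1
      nlinarith [mul_le_mul_of_nonneg_right h2 (norm_nonneg h)])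
    (Set.right_mem_Icc.2 zero_le_one)
  simpa [hh] using key

/-- The Baillon–Haddad inequality: the gradient of a convex `L`-smooth function is cocoercive. -/
lemma norm_gradient_sub_sq_le_of_lipschitz {f : F → ℝ} {L : ℝ} (hL : 0 < L)
    (hf : Differentiable ℝ f) (hconv : ∀ a b, f a + ⟪gradient f a, b - a⟫_ℝ ≤ f b)
    (hsmooth : ∀ a b, ‖gradient f a - gradient f b‖ ≤ L * ‖a - b‖) (a b : F) :
    ‖gradient f a - gradient f b‖ ^ 2 ≤ L * ⟪gradient f a - gradient f b, a - b⟫_ℝ := by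
  have half : ∀ a b, f a + ⟪gradient f a, b - a⟫_ℝ
      + L⁻¹ / 2 * ‖gradient f a - gradient f b‖ ^ 2 ≤ f b := by
    intro a b
    set g := gradient f a - gradient f b with hg
    have h1 := hconv a (b + L⁻¹ • g)
    have h2 := le_add_inner_gradient_add_sq_of_lipschitz hf hsmooth b (b + L⁻¹ • g)
    have h3 : ⟪gradient f a, g⟫_ℝ - ⟪gradient f b, g⟫_ℝ = ‖g‖ ^ 2 := by
      rw [← inner_sub_left, ← hg, real_inner_self_eq_norm_sq]
    rw [add_sub_cancel_left, norm_smul, mul_pow, norm_of_nonneg (by positivity),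
      inner_smul_right] at h2
    rw [add_sub_right_comm, inner_add_right, inner_smul_right] at h1
    have h4 : L / 2 * (L⁻¹ ^ 2 * ‖g‖ ^ 2) = L⁻¹ / 2 * ‖g‖ ^ 2 := by field_simp
    have h5 := congrArg (L⁻¹ * ·) h3
    simp only [mul_sub] at h5
    linarith
  have h1 := half a b
  have h2 := half b a
  rw [norm_sub_rev] at h2
  have h3 : ⟪gradient f a - gradient f b, a - b⟫_ℝ
      = -⟪gradient f a, b - a⟫_ℝ - ⟪gradient f b, a - b⟫_ℝ := by
    rw [inner_sub_left, ← neg_sub b a, inner_neg_right]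
  have h4 : L⁻¹ * ‖gradient f a - gradient f b‖ ^ 2
      ≤ ⟪gradient f a - gradient f b, a - b⟫_ℝ := by linarith
  rwa [inv_mul_le_iff₀ hL] at h4

end Gradient

section SecondOrder

variable {E : Type*} [NormedAddCommGroup E]

/-- A curve starting at rest whose acceleration is at most `L` times its norm stays within
distance `‖z 0‖ / 3` of its initial point up to time `1 / (2 * √L)`. -/
lemma norm_sub_initial_le_of_norm_accel_le [NormedSpace ℝ E] {z w g : ℝ → E} {L t : ℝ}
    (hL : 0 ≤ L) (ht : 0 ≤ t) (htL : L * t ^ 2 ≤ 1 / 4)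
    (hz : ∀ s ∈ Set.Icc 0 t, HasDerivAt z (w s) s)
    (hw : ∀ s ∈ Set.Icc 0 t, HasDerivAt w (g s) s)
    (hg : ∀ s ∈ Set.Icc 0 t, ‖g s‖ ≤ L * ‖z s‖) (h0 : w 0 = 0) :
    ∀ s ∈ Set.Icc 0 t, ‖z s - z 0‖ ≤ ‖z 0‖ / 3 := by
  obtain ⟨m, hm, hmax⟩ := isCompact_Icc.exists_isMaxOn (Set.nonempty_Icc.2 ht)
    (HasDerivAt.continuousOn hz).norm
  have hM : ∀ s ∈ Set.Icc 0 t, ‖z s‖ ≤ ‖z m‖ := fun s hs => hmax hs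
  have hwb : ∀ s ∈ Set.Icc 0 t, ‖w s‖ ≤ L * ‖z m‖ * t := by
    intro s hs
    have := norm_image_sub_le_of_norm_deriv_le_segment'
      (fun r hr => (hw r hr).hasDerivWithinAt)
      (fun r hr => (hg r (Set.Ico_subset_Icc_self hr)).trans
        (mul_le_mul_of_nonneg_left (hM r (Set.Ico_subset_Icc_self hr)) hL)) s hs
    rw [h0, sub_zero, sub_zero] at this
    exact this.trans (mul_le_mul_of_nonneg_left hs.2 (by positivity))
  have hzb : ∀ s ∈ Set.Icc 0 t, ‖z s - z 0‖ ≤ ‖z m‖ / 4 := by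
    intro s hs
    have h1 := norm_image_sub_le_of_norm_deriv_le_segment'
      (fun r hr => (hz r hr).hasDerivWithinAt)
      (fun r hr => hwb r (Set.Ico_subset_Icc_self hr)) s hs
    rw [sub_zero] at h1
    calc ‖z s - z 0‖ ≤ L * ‖z m‖ * t * t := h1.trans
          (mul_le_mul_of_nonneg_left hs.2 (by positivity))
      _ = L * t ^ 2 * ‖z m‖ := by ring
      _ ≤ 1 / 4 * ‖z m‖ := by gcongr
      _ = ‖z m‖ / 4 := by ring
  intro s hs
  linarith [hzb s hs, hzb m hm, norm_sub_norm_le (z m) (z 0)]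

/-- If `‖w'‖²` is bounded by a continuous function `b`, then `‖w t - w 0‖² ≤ t * ∫ b`. -/
lemma norm_image_sub_sq_le_mul_integral [InnerProductSpace ℝ E] {w g : ℝ → E} {b : ℝ → ℝ} {t : ℝ}
    (ht : 0 ≤ t) (hw : ∀ s ∈ Set.Icc 0 t, HasDerivAt w (g s) s)
    (hg : ContinuousOn g (Set.Icc 0 t)) (hb : ContinuousOn b (Set.Icc 0 t))
    (hgb : ∀ s ∈ Set.Icc 0 t, ‖g s‖ ^ 2 ≤ b s) :
    ‖w t - w 0‖ ^ 2 ≤ t * ∫ s in (0 : ℝ)..t, b s := by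
  rcases ht.eq_or_lt with rfl | ht0
  · simp
  set c := w t - w 0 with hc
  have hu : Set.uIcc 0 t = Set.Icc 0 t := Set.uIcc_of_le ht
  have hgi : IntervalIntegrable (fun s => ⟪g s, c⟫_ℝ) volume 0 t :=
    ContinuousOn.intervalIntegrable (by rw [hu]; exact hg.inner continuousOn_const)
  have hbi : IntervalIntegrable b volume 0 t :=
    ContinuousOn.intervalIntegrable (by rwa [hu])
  have h1 : ∫ s in (0 : ℝ)..t, ⟪g s, c⟫_ℝ = ‖c‖ ^ 2 := by
    rw [intervalIntegral.integral_eq_sub_of_hasDerivAt (f := fun s => ⟪w s, c⟫_ℝ)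
      (fun s hs => by
        simpa using (hw s (hu ▸ hs)).inner ℝ (hasDerivAt_const s c)) hgi,
      ← inner_sub_left, ← hc, real_inner_self_eq_norm_sq]
  have h2 : ∫ s in (0 : ℝ)..t, ⟪g s, c⟫_ℝ
      ≤ ∫ s in (0 : ℝ)..t, (t / 2 * b s + ‖c‖ ^ 2 / (2 * t)) := by
    refine intervalIntegral.integral_mono_on ht hgi
      ((hbi.const_mul _).add intervalIntegrable_const) fun s hs => ?_
    calc ⟪g s, c⟫_ℝ ≤ ‖g s‖ * ‖c‖ := real_inner_le_norm _ _
      _ ≤ t / 2 * ‖g s‖ ^ 2 + ‖c‖ ^ 2 / (2 * t) := by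
        rw [← sub_nonneg]
        have : t / 2 * ‖g s‖ ^ 2 + ‖c‖ ^ 2 / (2 * t) - ‖g s‖ * ‖c‖
            = (t * ‖g s‖ - ‖c‖) ^ 2 / (2 * t) := by field_simp; ring
        rw [this]
        positivity
      _ ≤ t / 2 * b s + ‖c‖ ^ 2 / (2 * t) := by gcongr; exact hgb s hs
  rw [h1, intervalIntegral.integral_add (hbi.const_mul _) intervalIntegrable_const,
    intervalIntegral.integral_const_mul, intervalIntegral.integral_const, smul_eq_mul,
    sub_zero] at h2
  have h3 : t * (‖c‖ ^ 2 / (2 * t)) = ‖c‖ ^ 2 / 2 := by field_simp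
  linarith

end SecondOrder

/-- If `f` is `μ`-strongly convex, convex and `L`-smooth, and `x, y` solve the Hamiltonian
ODE `x'' = -∇f(x)` with equal initial velocities `u, v` and distinct initial positions, then
with `ρ(s) = ⟨∇f(x(s)) - ∇f(y(s)), x(s) - y(s)⟩ / ‖x(s) - y(s)‖²`, for `0 ≤ t ≤ 1/(2√L)`:
`‖x'(t) - y'(t)‖² ≤ 2·L·t·(∫₀ᵗ ρ(s) ds)·‖x(0) - y(0)‖²`. -/
theorem hmc_velocity_rho_bound {d : ℕ} (μ L : ℝ) (hμ : 0 < μ) (hμL : μ ≤ L)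
    (f : EuclideanSpace ℝ (Fin d) → ℝ) (hf : ContDiff ℝ 1 f)
    (hstrong : ∀ a b : EuclideanSpace ℝ (Fin d),
      f b ≥ f a + ⟪gradient f a, b - a⟫_ℝ + μ / 2 * ‖b - a‖ ^ 2)
    (hconv : ConvexOn ℝ Set.univ f)
    (hsmooth : ∀ a b : EuclideanSpace ℝ (Fin d),
      ‖gradient f a - gradient f b‖ ≤ L * ‖a - b‖)
    (x y u v : ℝ → EuclideanSpace ℝ (Fin d))
    (hx : ∀ t, 0 ≤ t → HasDerivAt x (u t) t)
    (hu : ∀ t, 0 ≤ t → HasDerivAt u (-gradient f (x t)) t)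
    (hy : ∀ t, 0 ≤ t → HasDerivAt y (v t) t)
    (hv : ∀ t, 0 ≤ t → HasDerivAt v (-gradient f (y t)) t)
    (h0 : u 0 = v 0) (hxy0 : x 0 ≠ y 0) :
    ∀ t, 0 ≤ t → t ≤ 1 / (2 * Real.sqrt L) →
      ‖u t - v t‖ ^ 2 ≤
        2 * L * t *
          (∫ s in (0:ℝ)..t,
            ⟪gradient f (x s) - gradient f (y s), x s - y s⟫_ℝ / ‖x s - y s‖ ^ 2) *
          ‖x 0 - y 0‖ ^ 2 := by
  intro t ht htL
  have hL : 0 < L := hμ.trans_le hμL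
  have htL' : L * t ^ 2 ≤ 1 / 4 := by
    have h1 : t * (2 * √L) ≤ 1 := (le_div_iff₀ (by positivity)).1 htL
    nlinarith [Real.sq_sqrt hL.le, mul_nonneg ht (Real.sqrt_nonneg L)]
  have hfd : Differentiable ℝ f := hf.differentiable one_ne_zero
  have hgc : Continuous (gradient f) := by
    refine (LipschitzWith.of_dist_le_mul (K := L.toNNReal) fun a b => ?_).continuous
    rw [dist_eq_norm, dist_eq_norm, Real.coe_toNNReal L hL.le]
    exact hsmooth a b
  have hcoco := norm_gradient_sub_sq_le_of_lipschitz hL hfd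
    (fun a b => le_trans (le_add_of_nonneg_right (by positivity)) (hstrong a b)) hsmooth
  have hz : ∀ s ∈ Set.Icc 0 t, HasDerivAt (fun s => x s - y s) (u s - v s) s :=
    fun s hs => (hx s hs.1).sub (hy s hs.1)
  have hw : ∀ s ∈ Set.Icc 0 t, HasDerivAt (fun s => u s - v s)
      (gradient f (y s) - gradient f (x s)) s := fun s hs => by
    rw [← neg_sub_neg]
    exact (hu s hs.1).sub (hv s hs.1)
  have hclose := norm_sub_initial_le_of_norm_accel_le hL.le ht htL' hz hw
    (fun s _ => by rw [norm_sub_rev (x s)]; exact hsmooth _ _) (sub_eq_zero.2 h0)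
  have hD : 0 < ‖x 0 - y 0‖ := norm_pos_iff.2 (sub_ne_zero.2 hxy0)
  have hpos : ∀ s ∈ Set.Icc 0 t, 0 < ‖x s - y s‖ := fun s hs => by
    have h1 := norm_sub_norm_le (x 0 - y 0) (x s - y s)
    rw [norm_sub_rev (x 0 - y 0)] at h1
    linarith [hclose s hs]
  have hsq : ∀ s ∈ Set.Icc 0 t, ‖x s - y s‖ ^ 2 ≤ 2 * ‖x 0 - y 0‖ ^ 2 := fun s hs => by
    have h1 : ‖x s - y s‖ ≤ 4 / 3 * ‖x 0 - y 0‖ := by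
      linarith [hclose s hs, norm_sub_norm_le (x s - y s) (x 0 - y 0)]
    nlinarith [hpos s hs]
  have hxc : ContinuousOn x (Set.Icc 0 t) := HasDerivAt.continuousOn fun s hs => hx s hs.1
  have hyc : ContinuousOn y (Set.Icc 0 t) := HasDerivAt.continuousOn fun s hs => hy s hs.1
  have hgx := hgc.comp_continuousOn hxc
  have hgy := hgc.comp_continuousOn hyc
  have hρ : ContinuousOn (fun s => ⟪gradient f (x s) - gradient f (y s), x s - y s⟫_ℝ
      / ‖x s - y s‖ ^ 2) (Set.Icc 0 t) :=
    ((hgx.sub hgy).inner (hxc.sub hyc)).div ((hxc.sub hyc).norm.pow 2)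
      fun s hs => (pow_pos (hpos s hs) 2).ne'
  have key := norm_image_sub_sq_le_mul_integral ht hw (hgy.sub hgx)
    (hρ.const_mul (2 * L * ‖x 0 - y 0‖ ^ 2)) fun s hs => by
      have h1 := hcoco (x s) (y s)
      have h2 : 0 ≤ ⟪gradient f (x s) - gradient f (y s), x s - y s⟫_ℝ :=
        nonneg_of_mul_nonneg_right ((sq_nonneg _).trans h1) hL
      rw [norm_sub_rev]
      refine h1.trans ?_
      have h3 := pow_pos (hpos s hs) 2
      rw [mul_div_assoc', le_div_iff₀ h3]
      nlinarith [mul_le_mul_of_nonneg_left (hsq s hs) (mul_nonneg hL.le h2)]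
  simp only [h0, sub_self, sub_zero, intervalIntegral.integral_const_mul] at key
  linarith
end

section
/- Let L > 0, a ≥ 0, T > 0, and let g : [0,T] → ℝ be a continuous nonnegative function satisfying g(t) ≤ a + L·∫₀ᵗ (t - s)·g(s) ds for all t ∈ [0,T]. Then g(t) ≤ a·cosh(√L · t) for all t ∈ [0,T]. -/
open Real MeasureTheory

/-- A function with nonpositive derivative on `[0, T]` stays below its value at `0`. -/
lemma le_apply_zero_of_hasDerivAt_nonpos {f f' : ℝ → ℝ} {T : ℝ}
    (hf : ∀ t, HasDerivAt f (f' t) t) (hf' : ∀ t ∈ Set.Icc 0 T, f' t ≤ 0) :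
    ∀ t ∈ Set.Icc 0 T, f t ≤ f 0 := by
  intro t ht
  have hanti : AntitoneOn f (Set.Icc 0 T) := by
    refine antitoneOn_of_deriv_nonpos (convex_Icc 0 T)
      (fun x _ => (hf x).continuousAt.continuousWithinAt)
      (fun x _ => (hf x).differentiableAt.differentiableWithinAt) fun x hx => ?_
    rw [(hf x).deriv]
    exact hf' x (interior_subset hx)
  exact hanti ⟨le_rfl, ht.1.trans ht.2⟩ ht ht.1

/-- Comparison for `v'' ≤ k² v` with `v' 0 = 0`. -/
lemma le_mul_cosh_of_second_deriv_le {v p q : ℝ → ℝ} {k T : ℝ}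
    (hv : ∀ t, HasDerivAt v (p t) t) (hp : ∀ t, HasDerivAt p (q t) t) (hp0 : p 0 = 0)
    (hq : ∀ t ∈ Set.Icc 0 T, q t ≤ k ^ 2 * v t) :
    ∀ t ∈ Set.Icc 0 T, v t ≤ v 0 * cosh (k * t) := by
  have hexp (c t : ℝ) : HasDerivAt (fun s => exp (c * s)) (exp (c * t) * c) t := by
    simpa using ((hasDerivAt_id t).const_mul c).exp
  have hinv (t : ℝ) : exp (k * t) * exp (-k * t) = 1 := by
    rw [← exp_add]; simp
  have hsq (t : ℝ) : exp (2 * k * t) = exp (k * t) * exp (k * t) := by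
    rw [← exp_add]; ring_nf
  have hw : ∀ t ∈ Set.Icc 0 T, p t + k * v t ≤ k * v 0 * exp (k * t) := by
    intro t ht
    have h := le_apply_zero_of_hasDerivAt_nonpos (T := T)
      (fun t => ((hp t).add ((hv t).const_mul k)).mul (hexp (-k) t))
      (fun t ht => by
        have := mul_nonneg (sub_nonneg.2 (hq t ht)) (exp_pos (-k * t)).le
        simp only [Pi.add_apply]
        linarith) t ht
    simp only [Pi.mul_apply, Pi.add_apply, hp0, mul_zero, exp_zero, mul_one, zero_add] at h
    have := mul_le_mul_of_nonneg_right h (exp_pos (k * t)).le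
    rwa [mul_assoc, mul_comm (exp (-k * t)), hinv, mul_one] at this
  intro t ht
  have h := le_apply_zero_of_hasDerivAt_nonpos (T := T)
    (fun t => ((hv t).mul (hexp k t)).sub ((hexp (2 * k) t).const_mul (v 0 / 2)))
    (fun t ht => by
      have := mul_le_mul_of_nonneg_right (hw t ht) (exp_pos (k * t)).le
      rw [hsq]
      linarith) t ht
  simp only [Pi.sub_apply, Pi.mul_apply, mul_zero, exp_zero, mul_one, hsq] at h
  have := mul_le_mul_of_nonneg_right h (exp_pos (-k * t)).le
  rw [cosh_eq, ← neg_mul]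
  linear_combination this - (v t - v 0 / 2 * exp (k * t)) * hinv t

/-- **Second-order Grönwall-type integral inequality** (cf. Lemma A.5 of Lee–Song–Vempala):
if a continuous nonnegative `g : [0,T] → ℝ` satisfies `g(t) ≤ a + L·∫₀ᵗ (t-s)·g(s) ds`
for all `t ∈ [0,T]`, then `g(t) ≤ a·cosh(√L·t)` on `[0,T]`. -/
theorem gronwall_second_order (L a T : ℝ) (hL : 0 < L) (ha : 0 ≤ a) (hT : 0 < T)
    (g : ℝ → ℝ) (hg : ContinuousOn g (Set.Icc 0 T))
    (hg0 : ∀ t ∈ Set.Icc 0 T, 0 ≤ g t)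
    (hineq : ∀ t ∈ Set.Icc 0 T, g t ≤ a + L * ∫ s in (0:ℝ)..t, (t - s) * g s) :
    ∀ t ∈ Set.Icc 0 T, g t ≤ a * Real.cosh (Real.sqrt L * t) := by
  obtain ⟨G, hG, hGg⟩ : ∃ G : ℝ → ℝ, Continuous G ∧ ∀ t ∈ Set.Icc 0 T, G t = g t :=
    ⟨Set.IccExtend hT.le ((Set.Icc 0 T).domRestrict g), hg.domRestrict.Icc_extend',
      fun t ht => Set.IccExtend_of_mem hT.le _ ht⟩
  have hsG : Continuous fun s => s * G s := continuous_id.mul hG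
  set P : ℝ → ℝ := fun t => ∫ s in (0:ℝ)..t, G s with hP
  set Q : ℝ → ℝ := fun t => ∫ s in (0:ℝ)..t, s * G s with hQ
  have hP' (t : ℝ) : HasDerivAt P (G t) t := hG.integral_hasStrictDerivAt 0 t |>.hasDerivAt
  have hQ' (t : ℝ) : HasDerivAt Q (t * G t) t := hsG.integral_hasStrictDerivAt 0 t |>.hasDerivAt
  have hle : ∀ t ∈ Set.Icc 0 T, g t ≤ a + L * (t * P t - Q t) := by
    intro t ht
    refine (hineq t ht).trans_eq ?_
    have hcongr : ∫ s in (0:ℝ)..t, (t - s) * g s = ∫ s in (0:ℝ)..t, (t * G s - s * G s) := by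
      refine intervalIntegral.integral_congr fun s hs => ?_
      rw [Set.uIcc_of_le ht.1] at hs
      simp only [hGg s ⟨hs.1, hs.2.trans ht.2⟩, sub_mul]
    rw [hcongr, intervalIntegral.integral_sub
      ((hG.const_mul t).intervalIntegrable _ _) (hsG.intervalIntegrable _ _),
      intervalIntegral.integral_const_mul]
  have hv (t : ℝ) : HasDerivAt (fun t => a + L * (t * P t - Q t)) (L * P t) t := by
    exact (((((hasDerivAt_id t).mul (hP' t)).sub (hQ' t)).const_mul L).const_add a).congr_deriv
      (by simp)
  intro t ht
  have h := le_mul_cosh_of_second_deriv_le (k := √L) (T := T) hv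
    (fun t => (hP' t).const_mul L) (by simp [hP])
    (fun t ht => by
      rw [sq_sqrt hL.le, hGg t ht]
      exact mul_le_mul_of_nonneg_left (hle t ht) hL.le) t ht
  simp only [hQ, intervalIntegral.integral_same, zero_mul, sub_zero, mul_zero, add_zero] at h
  exact (hle t ht).trans h
end
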